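/- arXiv:2507.20572 — 5 statements merged into one kernel-verified Lean document; each statement's English description precedes it below -/
import Mathlib

section
/- Let K be a field and let 𝒜 be a non-unital, not necessarily associative algebra over K (an additive group with a K-module structure and K-bilinear multiplication) with a linear basis {e, f, g} and scalars i, j, k ∈ K satisfying e·e = i•e, f·f = j•f, g·g = k•g. Set A = e·f, B = e·g, C = f·e, D = f·g, E = g·e, F = g·f. Then 𝒜 is endo-commutative (i.e. (x·y)·(x·y) = (x·x)·(y·y) for all x, y ∈ 𝒜) if and only if both of the following hold. Condition (10): A·A = (i*j)•A; B·B = (i*k)•B; C·C = (i*j)•C; D·D = (j*k)•D; E·E = (i*k)•E; F·F = (j*k)•F; A·B + B·A = i•(e·(D+F)); C·E + E·C = i•((D+F)·e); C·D + D·C = j•(f·(B+E)); A·F + F·A = j•((B+E)·f); E·F + F·E = k•(g·(A+C)); B·D + D·B = k•((A+C)·g); i•(A·e) = i•(e·C); i•(B·e) = i•(e·E); j•(C·f) = j•(f·A); j•(D·f) = j•(f·F); k•(E·g) = k•(g·B); k•(F·g) = k•(g·D). Condition (17): B·C + B·A + E·C − A·E = i•(e·F + F·e); D·A + F·A + D·C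 − C·F = j•(E·f + f·E); D·B + F·B + F·E − E·D = k•(C·g + g·C). -/
section EndoCommutative

variable {K 𝒜 : Type*} [Field K] [NonUnitalNonAssocRing 𝒜] [Module K 𝒜]

/-- Squares of products of two curled elements in an endo-commutative algebra. -/
lemma mul_mul_self_of_endoCommutative [SMulCommClass K 𝒜 𝒜] [IsScalarTower K 𝒜 𝒜]
    (H : ∀ x y : 𝒜, (x * y) * (x * y) = (x * x) * (y * y))
    {a b : 𝒜} {α β : K} (ha : a * a = α • a) (hb : b * b = β • b) :
    (a * b) * (a * b) = (α * β) • (a * b) := by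
  rw [H, ha, hb, smul_mul_smul_comm]

/-- Polarization in the second variable at a curled element. -/
lemma polarize_right_of_endoCommutative [IsScalarTower K 𝒜 𝒜]
    (H : ∀ x y : 𝒜, (x * y) * (x * y) = (x * x) * (y * y))
    {a : 𝒜} {α : K} (ha : a * a = α • a) (b c : 𝒜) :
    (a * b) * (a * c) + (a * c) * (a * b) = α • (a * (b * c + c * b)) := by
  have h := H a (b + c)
  have hb := H a b
  have hc := H a c
  simp only [mul_add, add_mul, ha, smul_mul_assoc, smul_add] at h hb hc ⊢
  linear_combination (norm := module) h - hb - hc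

/-- Polarization in the first variable at a curled element. -/
lemma polarize_left_of_endoCommutative [SMulCommClass K 𝒜 𝒜]
    (H : ∀ x y : 𝒜, (x * y) * (x * y) = (x * x) * (y * y))
    {a : 𝒜} {α : K} (ha : a * a = α • a) (b c : 𝒜) :
    (b * a) * (c * a) + (c * a) * (b * a) = α • ((b * c + c * b) * a) := by
  have h := H (b + c) a
  have hb := H b a
  have hc := H c a
  simp only [mul_add, add_mul, ha, mul_smul_comm, smul_add] at h hb hc ⊢
  linear_combination (norm := module) h - hb - hc

/-- The flexibility-type identity at a curled element of an endo-commutative algebra. -/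
lemma smul_mul_mul_of_endoCommutative [SMulCommClass K 𝒜 𝒜] [IsScalarTower K 𝒜 𝒜]
    (H : ∀ x y : 𝒜, (x * y) * (x * y) = (x * x) * (y * y))
    {a : 𝒜} {α : K} (ha : a * a = α • a) (b : 𝒜) :
    α • ((a * b) * a) = α • (a * (b * a)) := by
  have h := polarize_right_of_endoCommutative H ha a b
  simp only [mul_add, ha, smul_mul_assoc, mul_smul_comm, smul_add] at h
  linear_combination (norm := module) h

/-- The mixed polarization, bilinear in both variables, at a curled element. -/
lemma polarize_mixed_of_endoCommutative [SMulCommClass K 𝒜 𝒜] [IsScalarTower K 𝒜 𝒜]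
    (H : ∀ x y : 𝒜, (x * y) * (x * y) = (x * x) * (y * y))
    {a : 𝒜} {α : K} (ha : a * a = α • a) (b c : 𝒜) :
    (a * c) * (b * a) + (a * c) * (a * b) + (c * a) * (b * a) - (a * b) * (c * a) =
      α • (a * (c * b) + (c * b) * a) := by
  have h := H (a + c) (a + b)
  have h₁ := H a (a + b)
  have h₂ := H c (a + b)
  have h₃ := H (a + c) a
  have h₄ := H (a + c) b
  have h₅ := H a b
  have h₆ := H c a
  have h₇ := H c b
  simp only [mul_add, add_mul, ha, smul_mul_assoc, mul_smul_comm, smul_add]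
    at h h₁ h₂ h₃ h₄ h₅ h₆ h₇ ⊢
  linear_combination (norm := module) -h + h₁ + h₂ + h₃ + h₄ - h₅ - h₆ - h₇

end EndoCommutative

/-- A 3-dimensional curled algebra of type `(i, j, k)` with basis `{e, f, g}` is
endo-commutative iff conditions (10) and (17) hold. -/
theorem endoCommutative_iff_conditions_ten_and_seventeen
    (K : Type*) [Field K] (𝒜 : Type*) [NonUnitalNonAssocRing 𝒜]
    [Module K 𝒜] [SMulCommClass K 𝒜 𝒜] [IsScalarTower K 𝒜 𝒜]
    (e f g : 𝒜)
    (hind : LinearIndependent K ![e, f, g])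
    (hspan : Submodule.span K {e, f, g} = ⊤)
    (i j k : K)
    (he : e * e = i • e) (hf : f * f = j • f) (hg : g * g = k • g)
    (A B C D E F : 𝒜)
    (hA : A = e * f) (hB : B = e * g) (hC : C = f * e)
    (hD : D = f * g) (hE : E = g * e) (hF : F = g * f) :
    (∀ x y : 𝒜, (x * y) * (x * y) = (x * x) * (y * y)) ↔
    ((A * A = (i * j) • A ∧
      B * B = (i * k) • B ∧
      C * C = (i * j) • C ∧
      D * D = (j * k) • D ∧
      E * E = (i * k) • E ∧
      F * F = (j * k) • F ∧
      A * B + B * A = i • (e * (D + F)) ∧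
      C * E + E * C = i • ((D + F) * e) ∧
      C * D + D * C = j • (f * (B + E)) ∧
      A * F + F * A = j • ((B + E) * f) ∧
      E * F + F * E = k • (g * (A + C)) ∧
      B * D + D * B = k • ((A + C) * g) ∧
      i • (A * e) = i • (e * C) ∧
      i • (B * e) = i • (e * E) ∧
      j • (C * f) = j • (f * A) ∧
      j • (D * f) = j • (f * F) ∧
      k • (E * g) = k • (g * B) ∧
      k • (F * g) = k • (g * D)) ∧
     (B * C + B * A + E * C - A * E = i • (e * F + F * e) ∧
      D * A + F * A + D * C - C * F = j • (E * f + f * E) ∧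
      D * B + F * B + F * E - E * D = k • (C * g + g * C))) := by
  constructor
  · intro H
    subst hA hB hC hD hE hF
    have sq_fe := mul_mul_self_of_endoCommutative H hf he
    have sq_ge := mul_mul_self_of_endoCommutative H hg he
    have sq_gf := mul_mul_self_of_endoCommutative H hg hf
    rw [mul_comm] at sq_fe sq_ge sq_gf
    have mixed_e := polarize_mixed_of_endoCommutative H he f g
    have mixed_f := polarize_mixed_of_endoCommutative H hf e g
    have mixed_g := polarize_mixed_of_endoCommutative H hg e f
    refine ⟨⟨mul_mul_self_of_endoCommutative H he hf, mul_mul_self_of_endoCommutative H he hg,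
      sq_fe, mul_mul_self_of_endoCommutative H hf hg, sq_ge, sq_gf,
      polarize_right_of_endoCommutative H he f g, polarize_left_of_endoCommutative H he f g,
      polarize_right_of_endoCommutative H hf e g, polarize_left_of_endoCommutative H hf e g,
      polarize_right_of_endoCommutative H hg e f, polarize_left_of_endoCommutative H hg e f,
      smul_mul_mul_of_endoCommutative H he f, smul_mul_mul_of_endoCommutative H he g,
      smul_mul_mul_of_endoCommutative H hf e, smul_mul_mul_of_endoCommutative H hf g,
      smul_mul_mul_of_endoCommutative H hg e, smul_mul_mul_of_endoCommutative H hg f⟩,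
      ?_, ?_, ?_⟩
    · linear_combination (norm := module) mixed_e
    · linear_combination (norm := module) mixed_f
    · linear_combination (norm := module) mixed_g
  · rintro ⟨⟨hAA, hBB, hCC, hDD, hEE, hFF, hAB, hCE, hCD, hAF, hEF, hBD,
      hAe, hBe, hCf, hDf, hEg, hFg⟩, he', hf', hg'⟩ x y
    have hx : x ∈ Submodule.span K {e, f, g} := hspan ▸ Submodule.mem_top
    have hy : y ∈ Submodule.span K {e, f, g} := hspan ▸ Submodule.mem_top
    obtain ⟨a₁, a₂, a₃, rfl⟩ := Submodule.mem_span_triple.1 hx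
    obtain ⟨b₁, b₂, b₃, rfl⟩ := Submodule.mem_span_triple.1 hy
    simp only [mul_add, add_mul, smul_mul_assoc, mul_smul_comm, smul_add, he, hf, hg,
      ← hA, ← hB, ← hC, ← hD, ← hE, ← hF] at hAB hCE hCD hAF hEF hBD he' hf' hg' ⊢
    linear_combination (norm := module)
      (a₁ ^ 2 * b₂ ^ 2 - a₁ * a₂ * b₁ * b₂) • hAA + (a₁ ^ 2 * b₃ ^ 2 - a₁ * a₃ * b₁ * b₃) • hBB
      + (a₂ ^ 2 * b₁ ^ 2 - a₁ * a₂ * b₁ * b₂) • hCC + (a₂ ^ 2 * b₃ ^ 2 - a₂ * a₃ * b₂ * b₃) • hDD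
      + (a₃ ^ 2 * b₁ ^ 2 - a₁ * a₃ * b₁ * b₃) • hEE + (a₃ ^ 2 * b₂ ^ 2 - a₂ * a₃ * b₂ * b₃) • hFF
      + (a₁ ^ 2 * b₂ * b₃ - a₁ * a₂ * b₁ * b₃) • hAB
      + (a₂ * a₃ * b₁ ^ 2 - a₁ * a₂ * b₁ * b₃) • hCE
      + (a₂ ^ 2 * b₁ * b₃ - a₁ * a₂ * b₂ * b₃) • hCD
      + (a₁ * a₃ * b₂ ^ 2 - a₁ * a₂ * b₂ * b₃) • hAF
      + (a₃ ^ 2 * b₁ * b₂ - a₁ * a₃ * b₂ * b₃) • hEF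
      + (a₁ * a₂ * b₃ ^ 2 - a₁ * a₃ * b₂ * b₃) • hBD
      + (a₁ ^ 2 * b₁ * b₂ - a₁ * a₂ * b₁ ^ 2) • hAe
      + (a₁ ^ 2 * b₁ * b₃ - a₁ * a₃ * b₁ ^ 2) • hBe
      + (a₂ ^ 2 * b₁ * b₂ - a₁ * a₂ * b₂ ^ 2) • hCf
      + (a₂ ^ 2 * b₂ * b₃ - a₂ * a₃ * b₂ ^ 2) • hDf
      + (a₃ ^ 2 * b₁ * b₃ - a₁ * a₃ * b₃ ^ 2) • hEg
      + (a₃ ^ 2 * b₂ * b₃ - a₂ * a₃ * b₃ ^ 2) • hFg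
      + (a₁ * a₂ * b₁ * b₃ - a₁ * a₃ * b₁ * b₂) • he'
      + (a₁ * a₂ * b₂ * b₃ - a₂ * a₃ * b₁ * b₂) • hf'
      + (a₁ * a₃ * b₂ * b₃ - a₂ * a₃ * b₁ * b₃) • hg'
end

section
/- Let K be a field and let 𝒜 be a non-unital, not necessarily associative algebra over K with elements e, f, g ∈ 𝒜 and scalars i, j, k ∈ K satisfying e·e = i•e, f·f = j•f, g·g = k•g. Set A = e·f, B = e·g, C = f·e, D = f·g, E = g·e, F = g·f. If (x·y)·(x·y) = (x·x)·(y·y) holds for all x, y ∈ 𝒜, then all eighteen equations of condition (10) hold: A·A = (i*j)•A; B·B = (i*k)•B; C·C = (i*j)•C; D·D = (j*k)•D; E·E = (i*k)•E; F·F = (j*k)•F; A·B + B·A = i•(e·(D+F)); C·E + E·C = i•((D+F)·e); C·D + D·C = j•(f·(B+E)); A·F + F·A = j•((B+E)·f); E·F + F·E = k•(g·(A+C)); B·D + D·B = k•((A+C)·g); i•(A·e) = i•(e·C); i•(B·e) = i•(e·E); j•(C·f) = j•(f·A); j•(D·f) = j•(f·F); k•(E·g) = k•(g·B); k•(F·g)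 = k•(g·D). -/
/-- Polarization of endo-commutativity in the right factor. -/
theorem endoCommutative_polarize_right {R : Type*} [NonUnitalNonAssocRing R]
    (hec : ∀ x y : R, (x * y) * (x * y) = (x * x) * (y * y)) (x y z : R) :
    (x * y) * (x * z) + (x * z) * (x * y) = (x * x) * (y * z + z * y) := by
  have h := hec x (y + z)
  simp only [mul_add, add_mul, hec x y, hec x z] at h ⊢
  rw [← sub_eq_zero] at h ⊢
  rw [← h]
  abel

/-- Polarization of endo-commutativity in the left factor. -/
theorem endoCommutative_polarize_left {R : Type*} [NonUnitalNonAssocRing R]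
    (hec : ∀ x y : R, (x * y) * (x * y) = (x * x) * (y * y)) (x y z : R) :
    (y * x) * (z * x) + (z * x) * (y * x) = (y * z + z * y) * (x * x) := by
  have h := hec (y + z) x
  simp only [mul_add, add_mul, hec y x, hec z x] at h ⊢
  rw [← sub_eq_zero] at h ⊢
  rw [← h]
  abel

/-- In an endo-commutative ring, multiplying `x * y` by the square `x * x` on the right equals
multiplying `y * x` by it on the left. -/
theorem endoCommutative_mul_sq {R : Type*} [NonUnitalNonAssocRing R]
    (hec : ∀ x y : R, (x * y) * (x * y) = (x * x) * (y * y)) (x y : R) :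
    (x * y) * (x * x) = (x * x) * (y * x) := by
  have h := endoCommutative_polarize_right hec x x y
  rw [mul_add] at h
  exact add_left_cancel h

/-- If a non-unital, not necessarily associative algebra `𝒜` over a field `K`
with elements `e, f, g` satisfying `e·e = i•e`, `f·f = j•f`, `g·g = k•g`
is endo-commutative, then all eighteen equations of condition (10) hold. -/
theorem condition_ten_of_endoCommutative
    (K : Type*) [Field K] (𝒜 : Type*) [NonUnitalNonAssocRing 𝒜]
    [Module K 𝒜] [SMulCommClass K 𝒜 𝒜] [IsScalarTower K 𝒜 𝒜]
    (e f g : 𝒜) (i j k : K)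
    (he : e * e = i • e) (hf : f * f = j • f) (hg : g * g = k • g)
    (A B C D E F : 𝒜)
    (hA : A = e * f) (hB : B = e * g) (hC : C = f * e)
    (hD : D = f * g) (hE : E = g * e) (hF : F = g * f)
    (hec : ∀ x y : 𝒜, (x * y) * (x * y) = (x * x) * (y * y)) :
    A * A = (i * j) • A ∧
    B * B = (i * k) • B ∧
    C * C = (i * j) • C ∧
    D * D = (j * k) • D ∧
    E * E = (i * k) • E ∧
    F * F = (j * k) • F ∧
    A * B + B * A = i • (e * (D + F)) ∧
    C * E + E * C = i • ((D + F) * e) ∧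
    C * D + D * C = j • (f * (B + E)) ∧
    A * F + F * A = j • ((B + E) * f) ∧
    E * F + F * E = k • (g * (A + C)) ∧
    B * D + D * B = k • ((A + C) * g) ∧
    i • (A * e) = i • (e * C) ∧
    i • (B * e) = i • (e * E) ∧
    j • (C * f) = j • (f * A) ∧
    j • (D * f) = j • (f * F) ∧
    k • (E * g) = k • (g * B) ∧
    k • (F * g) = k • (g * D) := by
  subst hA hB hC hD hE hF
  have hr := endoCommutative_polarize_right hec
  have hl := endoCommutative_polarize_left hec
  have hs := endoCommutative_mul_sq hec
  refine ⟨?_, ?_, ?_, ?_, ?_, ?_, ?_, ?_, ?_, ?_, ?_, ?_, ?_, ?_, ?_, ?_, ?_, ?_⟩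
  · rw [hec, he, hf, smul_mul_smul_comm]
  · rw [hec, he, hg, smul_mul_smul_comm]
  · rw [hec, he, hf, smul_mul_smul_comm, mul_comm j i]
  · rw [hec, hf, hg, smul_mul_smul_comm]
  · rw [hec, he, hg, smul_mul_smul_comm, mul_comm k i]
  · rw [hec, hf, hg, smul_mul_smul_comm, mul_comm k j]
  · rw [hr, he, smul_mul_assoc]
  · rw [hl, he, mul_smul_comm]
  · rw [hr, hf, smul_mul_assoc]
  · rw [hl, hf, mul_smul_comm]
  · rw [hr, hg, smul_mul_assoc]
  · rw [hl, hg, mul_smul_comm]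
  · simpa only [he, mul_smul_comm, smul_mul_assoc] using hs e f
  · simpa only [he, mul_smul_comm, smul_mul_assoc] using hs e g
  · simpa only [hf, mul_smul_comm, smul_mul_assoc] using hs f e
  · simpa only [hf, mul_smul_comm, smul_mul_assoc] using hs f g
  · simpa only [hg, mul_smul_comm, smul_mul_assoc] using hs g e
  · simpa only [hg, mul_smul_comm, smul_mul_assoc] using hs g f
end

section
/- Let K be a field and let 𝒜 be a non-unital, not necessarily associative algebra over K spanned by elements e, f, g, with scalars i, j, k ∈ K satisfying e·e = i•e, f·f = j•f, g·g = k•g. Set A = e·f, B = e·g, C = f·e, D = f·g, E = g·e, F = g·f. Suppose the eighteen equations of condition (10) hold: A·A = (i*j)•A; B·B = (i*k)•B; C·C = (i*j)•C; D·D = (j*k)•D; E·E = (i*k)•E; F·F = (j*k)•F; A·B + B·A = i•(e·(D+F)); C·E + E·C = i•((D+F)·e); C·D + D·C = j•(f·(B+E)); A·F + F·A = j•((B+E)·f); E·F + F·E = k•(g·(A+C)); B·D + D·B = k•((A+C)·g); i•(A·e) = i•(e·C); i•(B·e) = i•(e·E); j•(C·f) = j•(f·A); j•(D·f) = j•(f·F);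 k•(E·g) = k•(g·B); k•(F·g) = k•(g·D); and suppose the three equations of condition (17) hold: B·C + B·A + E·C − A·E = i•(e·F + F·e); D·A + F·A + D·C − C·F = j•(E·f + f·E); D·B + F·B + F·E − E·D = k•(C·g + g·C). Then 𝒜 is endo-commutative: (x·y)·(x·y) = (x·x)·(y·y) for all x, y ∈ 𝒜. -/
/-- If a non-unital nonassociative algebra over a field is spanned by `e, f, g`
with `e·e = i•e`, `f·f = j•f`, `g·g = k•g`, and conditions (10) and (17) hold,
then the algebra is endo-commutative. -/
theorem endoCommutative_of_conditions_ten_and_seventeen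
    (K : Type*) [Field K] (𝒜 : Type*) [NonUnitalNonAssocRing 𝒜]
    [Module K 𝒜] [SMulCommClass K 𝒜 𝒜] [IsScalarTower K 𝒜 𝒜]
    (e f g : 𝒜)
    (hspan : Submodule.span K {e, f, g} = ⊤)
    (i j k : K)
    (he : e * e = i • e) (hf : f * f = j • f) (hg : g * g = k • g)
    (A B C D E F : 𝒜)
    (hA : A = e * f) (hB : B = e * g) (hC : C = f * e)
    (hD : D = f * g) (hE : E = g * e) (hF : F = g * f)
    (h1 : A * A = (i * j) • A)
    (h2 : B * B = (i * k) • B)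
    (h3 : C * C = (i * j) • C)
    (h4 : D * D = (j * k) • D)
    (h5 : E * E = (i * k) • E)
    (h6 : F * F = (j * k) • F)
    (h7 : A * B + B * A = i • (e * (D + F)))
    (h8 : C * E + E * C = i • ((D + F) * e))
    (h9 : C * D + D * C = j • (f * (B + E)))
    (h10 : A * F + F * A = j • ((B + E) * f))
    (h11 : E * F + F * E = k • (g * (A + C)))
    (h12 : B * D + D * B = k • ((A + C) * g))
    (h13 : i • (A * e) = i • (e * C))
    (h14 : i • (B * e) = i • (e * E))
    (h15 : j • (C * f) = j • (f * A))
    (h16 : j • (D * f) = j • (f * F))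
    (h17 : k • (E * g) = k • (g * B))
    (h18 : k • (F * g) = k • (g * D))
    (h19 : B * C + B * A + E * C - A * E = i • (e * F + F * e))
    (h20 : D * A + F * A + D * C - C * F = j • (E * f + f * E))
    (h21 : D * B + F * B + F * E - E * D = k • (C * g + g * C)) :
    ∀ x y : 𝒜, (x * y) * (x * y) = (x * x) * (y * y) := by
  intro x y
  have coords (z : 𝒜) : ∃ a b c : K, a • e + b • f + c • g = z :=
    Submodule.mem_span_triple.mp (hspan ▸ Submodule.mem_top)
  obtain ⟨a, b, c, rfl⟩ := coords x
  obtain ⟨p, q, r, rfl⟩ := coords y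
  simp only [mul_add, add_mul, smul_mul_assoc, mul_smul_comm, he, hf, hg,
    ← hA, ← hB, ← hC, ← hD, ← hE, ← hF] at *
  linear_combination (norm := module)
    (a ^ 2 * q ^ 2 - a * b * p * q) • h1 + (a ^ 2 * r ^ 2 - a * c * p * r) • h2
    + (b ^ 2 * p ^ 2 - a * b * p * q) • h3 + (b ^ 2 * r ^ 2 - b * c * q * r) • h4
    + (c ^ 2 * p ^ 2 - a * c * p * r) • h5 + (c ^ 2 * q ^ 2 - b * c * q * r) • h6
    + (a ^ 2 * q * r - a * b * p * r) • h7 + (b * c * p ^ 2 - a * b * p * r) • h8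
    + (b ^ 2 * p * r - a * b * q * r) • h9 + (a * c * q ^ 2 - a * b * q * r) • h10
    + (c ^ 2 * p * q - a * c * q * r) • h11 + (a * b * r ^ 2 - a * c * q * r) • h12
    + (a ^ 2 * p * q - a * b * p ^ 2) • h13 + (a ^ 2 * p * r - a * c * p ^ 2) • h14
    + (b ^ 2 * p * q - a * b * q ^ 2) • h15 + (b ^ 2 * q * r - b * c * q ^ 2) • h16
    + (c ^ 2 * p * r - a * c * r ^ 2) • h17 + (c ^ 2 * q * r - b * c * r ^ 2) • h18
    + (a * b * p * r - a * c * p * q) • h19 + (a * b * q * r - b * c * p * q) • h20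
    + (a * c * q * r - b * c * p * r) • h21
end

section
/- Let K be a field and let 𝒜 be a non-unital, not necessarily associative algebra over K with elements e, f, g ∈ 𝒜 and scalars i, j, k ∈ K satisfying e·e = i•e, f·f = j•f, g·g = k•g. Set A = e·f, B = e·g, C = f·e, D = f·g, E = g·e, F = g·f, and suppose the eighteen equations of condition (10) hold: A·A = (i*j)•A; B·B = (i*k)•B; C·C = (i*j)•C; D·D = (j*k)•D; E·E = (i*k)•E; F·F = (j*k)•F; A·B + B·A = i•(e·(D+F)); C·E + E·C = i•((D+F)·e); C·D + D·C = j•(f·(B+E)); A·F + F·A = j•((B+E)·f); E·F + F·E = k•(g·(A+C)); B·D + D·B = k•((A+C)·g); i•(A·e) = i•(e·C); i•(B·e) = i•(e·E); j•(C·f) = j•(f·A); j•(D·f) = j•(f·F); k•(E·g) = k•(g·B); k•(F·g) = k•(g·D). Then for all scalars a, b, c, u, v, w ∈ K, setting x = a•e + b•f + c•g and y = u•e + v•f + w•g, one has (x·y)·(x·y) − (x·x)·(y·y) = (a*u*(c*v − b*w)) • (A·E − B·C − B·A + i•(e·F) − E·C + i•(F·e)) + (b*v*(a*w − c*u)) •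 (D·A − C·F + F·A − j•(E·f) + D·C − j•(f·E)) + (c*w*(a*v − b*u)) • (D·B + F·B − E·D + F·E − k•(C·g) − k•(g·C)). -/
/-- Under condition (10), the difference `(xy)² − x²y²` for
`x = a•e + b•f + c•g`, `y = u•e + v•f + w•g` reduces to the expression in
equation (16). -/
theorem difference_formula_of_condition_ten
    (K : Type*) [Field K] (𝒜 : Type*) [NonUnitalNonAssocRing 𝒜]
    [Module K 𝒜] [SMulCommClass K 𝒜 𝒜] [IsScalarTower K 𝒜 𝒜]
    (e f g : 𝒜) (i j k : K)
    (he : e * e = i • e) (hf : f * f = j • f) (hg : g * g = k • g)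
    (A B C D E F : 𝒜)
    (hA : A = e * f) (hB : B = e * g) (hC : C = f * e)
    (hD : D = f * g) (hE : E = g * e) (hF : F = g * f)
    (h1 : A * A = (i * j) • A)
    (h2 : B * B = (i * k) • B)
    (h3 : C * C = (i * j) • C)
    (h4 : D * D = (j * k) • D)
    (h5 : E * E = (i * k) • E)
    (h6 : F * F = (j * k) • F)
    (h7 : A * B + B * A = i • (e * (D + F)))
    (h8 : C * E + E * C = i • ((D + F) * e))
    (h9 : C * D + D * C = j • (f * (B + E)))
    (h10 : A * F + F * A = j • ((B + E) * f))
    (h11 : E * F + F * E = k • (g * (A + C)))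
    (h12 : B * D + D * B = k • ((A + C) * g))
    (h13 : i • (A * e) = i • (e * C))
    (h14 : i • (B * e) = i • (e * E))
    (h15 : j • (C * f) = j • (f * A))
    (h16 : j • (D * f) = j • (f * F))
    (h17 : k • (E * g) = k • (g * B))
    (h18 : k • (F * g) = k • (g * D)) :
    ∀ a b c u v w : K,
      (a • e + b • f + c • g) * (u • e + v • f + w • g) *
          ((a • e + b • f + c • g) * (u • e + v • f + w • g)) -
        (a • e + b • f + c • g) * (a • e + b • f + c • g) *
          ((u • e + v • f + w • g) * (u • e + v • f + w • g)) =
      (a * u * (c * v - b * w)) •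
          (A * E - B * C - B * A + i • (e * F) - E * C + i • (F * e)) +
        (b * v * (a * w - c * u)) •
          (D * A - C * F + F * A - j • (E * f) + D * C - j • (f * E)) +
        (c * w * (a * v - b * u)) •
          (D * B + F * B - E * D + F * E - k • (C * g) - k • (g * C)) := by
  intro a b c u v w
  have hmul : ∀ a b c u v w : K,
      (a • e + b • f + c • g) * (u • e + v • f + w • g) =
        (a * u * i) • e + (b * v * j) • f + (c * w * k) • g + (a * v) • A + (a * w) • B +
          (b * u) • C + (b * w) • D + (c * u) • E + (c * v) • F := by
    intro a b c u v w
    simp only [add_mul, mul_add, smul_mul_assoc, mul_smul_comm, he, hf, hg,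
      ← hA, ← hB, ← hC, ← hD, ← hE, ← hF]
    module
  simp only [mul_add, add_mul] at h7 h8 h9 h10 h11 h12
  simp only [hmul]
  simp only [add_mul, mul_add, smul_mul_assoc, mul_smul_comm, he, hf, hg,
    ← hA, ← hB, ← hC, ← hD, ← hE, ← hF]
  linear_combination (norm := module)
    (a ^ 2 * v ^ 2 - a * b * u * v) • h1 + (a ^ 2 * w ^ 2 - a * c * u * w) • h2 +
    (b ^ 2 * u ^ 2 - a * b * u * v) • h3 + (b ^ 2 * w ^ 2 - b * c * v * w) • h4 +
    (c ^ 2 * u ^ 2 - a * c * u * w) • h5 + (c ^ 2 * v ^ 2 - b * c * v * w) • h6 +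
    (a ^ 2 * v * w - a * b * u * w) • h7 + (b * c * u ^ 2 - a * b * u * w) • h8 +
    (b ^ 2 * u * w - a * b * v * w) • h9 + (a * c * v ^ 2 - a * b * v * w) • h10 +
    (c ^ 2 * u * v - a * c * v * w) • h11 + (a * b * w ^ 2 - a * c * v * w) • h12 +
    (a ^ 2 * u * v - a * b * u ^ 2) • h13 + (a ^ 2 * u * w - a * c * u ^ 2) • h14 +
    (b ^ 2 * u * v - a * b * v ^ 2) • h15 + (b ^ 2 * v * w - b * c * v ^ 2) • h16 +
    (c ^ 2 * u * w - a * c * w ^ 2) • h17 + (c ^ 2 * v * w - b * c * w ^ 2) • h18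
end

section
/- Let K be a field and let 𝒜 be a non-unital, not necessarily associative algebra over K with elements e, f, g ∈ 𝒜 and scalars i, j, k ∈ K satisfying e·e = i•e, f·f = j•f, g·g = k•g. Set A = e·f, B = e·g, C = f·e, D = f·g, E = g·e, F = g·f. If (x·y)·(x·y) = (x·x)·(y·y) holds for all x, y ∈ 𝒜, then: C·C = (i*j)•C; E·E = (i*k)•E; C·E + E·C = i•((D+F)·e); i•(e·C) = i•(A·e); and i•(e·E) = i•(B·e). -/
/-- Polarization of the endo-commutativity identity in its first variable. -/
theorem mul_mul_mul_add_mul_mul_mul_of_endoCommutative {R : Type*} [NonUnitalNonAssocRing R]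
    (hec : ∀ x y : R, (x * y) * (x * y) = (x * x) * (y * y)) (u v y : R) :
    (u * y) * (v * y) + (v * y) * (u * y) = (u * v + v * u) * (y * y) := by
  have h := hec (u + v) y
  simp only [add_mul, mul_add, hec u y, hec v y] at h ⊢
  rw [← sub_eq_zero] at h ⊢
  rw [← h]
  abel


/-- The five equations obtained by substituting y = e into the endo-commutativity identity (equation (7)). -/
theorem eq_system_seven
    (K : Type*) [Field K] (𝒜 : Type*) [NonUnitalNonAssocRing 𝒜]
    [Module K 𝒜] [SMulCommClass K 𝒜 𝒜] [IsScalarTower K 𝒜 𝒜]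
    (e f g : 𝒜) (i j k : K)
    (he : e * e = i • e) (hf : f * f = j • f) (hg : g * g = k • g)
    (A B C D E F : 𝒜)
    (hA : A = e * f) (hB : B = e * g) (hC : C = f * e)
    (hD : D = f * g) (hE : E = g * e) (hF : F = g * f)
    (hec : ∀ x y : 𝒜, (x * y) * (x * y) = (x * x) * (y * y)) :
    C * C = (i * j) • C ∧
    E * E = (i * k) • E ∧
    C * E + E * C = i • ((D + F) * e) ∧
    i • (e * C) = i • (A * e) ∧
    i • (e * E) = i • (B * e) := by
  subst hA hB hC hD hE hF
  have cross : ∀ u : 𝒜, i • (e * (u * e)) = i • ((e * u) * e) := fun u => by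
    have h := mul_mul_mul_add_mul_mul_mul_of_endoCommutative hec e u e
    simp only [he, smul_mul_assoc, mul_smul_comm, add_mul, smul_add] at h
    exact add_right_cancel h
  refine ⟨?_, ?_, ?_, cross f, cross g⟩
  · rw [hec, hf, he, smul_mul_smul_comm, mul_comm j i]
  · rw [hec, hg, he, smul_mul_smul_comm, mul_comm k i]
  · rw [mul_mul_mul_add_mul_mul_mul_of_endoCommutative hec, he, mul_smul_comm]
end
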